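/- arXiv:math/0510025 — 2 statements merged into one kernel-verified Lean document; each statement's English description precedes it below -/
import Mathlib

section
/- Let k be a field with char k = 3, and let I_3(3,5) be the ideal of 3×3 subpermanents of the generic 3×5 matrix M = (x_{i,j}) in k[x_{i,j} : 1 ≤ i ≤ 3, 1 ≤ j ≤ 5]. Then every prime ideal 𝔭 containing I_3(3,5) either contains an entire column of M, or contains all 2×2 permanents of some two rows of M, or there is a set S of 4 columns of M such that 𝔭 contains all 2×2 minors x_{i,j} x_{i',j'} - x_{i,j'} x_{i',j} with j, j' ∈ S. -/
open MvPolynomial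

/-- The ideal of `d × d` subpermanents of the generic `m × n` matrix. -/
noncomputable def permIdeal (k : Type*) [Field k] (d m n : ℕ) :
    Ideal (MvPolynomial (Fin m × Fin n) k) :=
  Ideal.span {p | ∃ (r : Fin d → Fin m) (c : Fin d → Fin n), StrictMono r ∧ StrictMono c ∧
    p = Matrix.permanent (Matrix.of fun i j => X (r i, c j))}

/-- All `3 × 3` subpermanents of `M` vanish, for every ordering of rows and columns. -/
def SubpermanentsVanish {K : Type*} [Field K] (M : Fin 3 → Fin 5 → K) : Prop :=
  ∀ r s t : Fin 3, r ≠ s → r ≠ t → s ≠ t → ∀ i j l : Fin 5, i ≠ j → i ≠ l → j ≠ l →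
    M r i * (M s j * M t l + M s l * M t j) + M s i * (M r j * M t l + M r l * M t j) +
      M t i * (M r j * M s l + M r l * M s j) = 0

/-- The `2 × 2` permanents of some two rows of `M` vanish. -/
def TwoRowPermanentsVanish {K : Type*} [Field K] (M : Fin 3 → Fin 5 → K) : Prop :=
  ∃ r r' : Fin 3, r ≠ r' ∧ ∀ j j' : Fin 5, j < j' → M r j * M r' j' + M r j' * M r' j = 0

/-- Some four columns of `M` have vanishing `2 × 2` minors. -/
def FourColumnMinorsVanish {K : Type*} [Field K] (M : Fin 3 → Fin 5 → K) : Prop :=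
  ∃ S : Finset (Fin 5), S.card = 4 ∧ ∀ (i i' : Fin 3) (j j' : Fin 5), j ∈ S → j' ∈ S →
    M i j * M i' j' - M i j' * M i' j = 0

lemma permanent_fin_three {R : Type*} [CommRing R] (A : Matrix (Fin 3) (Fin 3) R) :
    A.permanent = A 0 0 * (A 1 1 * A 2 2 + A 1 2 * A 2 1) +
      A 1 0 * (A 0 1 * A 2 2 + A 0 2 * A 2 1) + A 2 0 * (A 0 1 * A 1 2 + A 0 2 * A 1 1) := by
  simp only [Matrix.permanent, Finset.univ_perm_fin_succ, Finset.sum_map,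
    ← Finset.univ_product_univ, Finset.sum_product, Fin.sum_univ_succ, Fin.prod_univ_succ]
  have h0 : Equiv.Perm.decomposeFin.symm ((0 : Fin 3), Equiv.swap (0 : Fin 2) 1) 2 = 1 := by decide
  have h1 : Equiv.Perm.decomposeFin.symm ((1 : Fin 3), Equiv.swap (0 : Fin 2) 1) 2 = 0 := by decide
  have h2 : Equiv.Perm.decomposeFin.symm ((2 : Fin 3), Equiv.swap (0 : Fin 2) 1) 2 = 1 := by decide
  simp [Fin.succ_one_eq_two, Equiv.swap_apply_of_ne_of_ne, h0, h1, h2]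
  ring

lemma exists_notMem_of_card_le_four {s : Finset (Fin 5)} (hs : s.card ≤ 4) : ∃ a, a ∉ s := by
  by_contra! h
  rw [Finset.eq_univ_iff_forall.mpr h, Finset.card_fin] at hs
  omega

section Field

variable {K : Type*} [Field K] {M : Fin 3 → Fin 5 → K}

lemma eq_or_eq_or_eq_of_distinct {r s t : Fin 3} (hrs : r ≠ s) (hrt : r ≠ t) (hst : s ≠ t)
    (i : Fin 3) : i = r ∨ i = s ∨ i = t := by
  omega

lemma subpermanentsVanish_of_lt
    (h : ∀ i j l : Fin 5, i < j → j < l →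
      M 0 i * (M 1 j * M 2 l + M 1 l * M 2 j) + M 1 i * (M 0 j * M 2 l + M 0 l * M 2 j) +
        M 2 i * (M 0 j * M 1 l + M 0 l * M 1 j) = 0) :
    SubpermanentsVanish M := by
  have hcol : ∀ i j l : Fin 5, i ≠ j → i ≠ l → j ≠ l →
      M 0 i * (M 1 j * M 2 l + M 1 l * M 2 j) + M 1 i * (M 0 j * M 2 l + M 0 l * M 2 j) +
        M 2 i * (M 0 j * M 1 l + M 0 l * M 1 j) = 0 := by
    intro i j l hij hil hjl
    rcases lt_or_gt_of_ne hij with h1 | h1 <;> rcases lt_or_gt_of_ne hil with h2 | h2 <;>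
      rcases lt_or_gt_of_ne hjl with h3 | h3
    · linear_combination h i j l h1 h3
    · linear_combination h i l j h2 h3
    · exact absurd (h1.trans h3) h2.asymm
    · linear_combination h l i j h2 h1
    · linear_combination h j i l h1 h2
    · exact absurd (h2.trans h3) h1.asymm
    · linear_combination h j l i h3 h2
    · linear_combination h l j i h3 h1
  intro r s t hrs hrt hst i j l hij hil hjl
  have H := hcol i j l hij hil hjl
  have hcases : ∀ r s t : Fin 3, r ≠ s → r ≠ t → s ≠ t →
      (r = 0 ∧ s = 1 ∧ t = 2) ∨ (r = 0 ∧ s = 2 ∧ t = 1) ∨ (r = 1 ∧ s = 0 ∧ t = 2) ∨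
      (r = 1 ∧ s = 2 ∧ t = 0) ∨ (r = 2 ∧ s = 0 ∧ t = 1) ∨ (r = 2 ∧ s = 1 ∧ t = 0) := by
    decide
  rcases hcases r s t hrs hrt hst with ⟨rfl, rfl, rfl⟩ | ⟨rfl, rfl, rfl⟩ | ⟨rfl, rfl, rfl⟩ | ⟨rfl, rfl, rfl⟩ |
    ⟨rfl, rfl, rfl⟩ | ⟨rfl, rfl, rfl⟩ <;> linear_combination H

lemma twoRowPermanentsVanish_of_row_eq_zero {t : Fin 3} (ht : ∀ j, M t j = 0) :
    TwoRowPermanentsVanish M := by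
  obtain ⟨r, hr⟩ := exists_ne t
  exact ⟨r, t, hr, fun j j' _ => by simp [ht]⟩

lemma twoRowPermanentsVanish_of_two_zeros (hM : SubpermanentsVanish M)
    {r s t : Fin 3} (hrs : r ≠ s) (hrt : r ≠ t) (hst : s ≠ t) {a : Fin 5}
    (hr : M r a = 0) (ht : M t a = 0) (hs : M s a ≠ 0) : TwoRowPermanentsVanish M := by
  refine ⟨r, t, hrt, fun j j' hjj' => ?_⟩
  by_cases hj : a = j
  · subst hj; simp [hr, ht]
  by_cases hj' : a = j'
  · subst hj'; simp [hr, ht]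
  have h := hM r s t hrs hrt hst a j j' hj hj' hjj'.ne
  rw [hr, ht] at h
  have h' : M s a * (M r j * M t j' + M r j' * M t j) = 0 := by linear_combination h
  exact (mul_eq_zero.mp h').resolve_left hs

/-- If `d` and `e` have vanishing permanents with `c` in the row pairs `(r, t)` and `(s, t)` and
`c` is nonzero in row `t`, then `d` and `e` are proportional. -/
lemma det_eq_zero_of_permanents_eq_zero {cr cs ct dr ds dt er es et : K} (hc : ct ≠ 0)
    (h1 : cr * dt + ct * dr = 0) (h2 : cs * dt + ct * ds = 0)
    (h3 : cr * et + ct * er = 0) (h4 : cs * et + ct * es = 0) :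
    cr * (ds * et - dt * es) - cs * (dr * et - dt * er) + ct * (dr * es - ds * er) = 0 := by
  have e1 : dr = -(cr * dt) / ct := by rw [eq_div_iff hc]; linear_combination h1
  have e2 : ds = -(cs * dt) / ct := by rw [eq_div_iff hc]; linear_combination h2
  have e3 : er = -(cr * et) / ct := by rw [eq_div_iff hc]; linear_combination h3
  have e4 : es = -(cs * et) / ct := by rw [eq_div_iff hc]; linear_combination h4
  rw [e1, e2, e3, e4]
  field_simp
  ring

/-- The case where both remaining entries of a column with a zero entry are nonzero. -/
lemma det_eq_zero_of_pair {r s t : Fin 3} (hM : SubpermanentsVanish M) (h2 : (2 : K) ≠ 0)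
    (hrs : r ≠ s) (hrt : r ≠ t) (hst : s ≠ t) {a b c d e : Fin 5}
    (hac : a ≠ c) (had : a ≠ d) (hae : a ≠ e) (hbc : b ≠ c) (hbd : b ≠ d) (hbe : b ≠ e)
    (hcd : c ≠ d) (hce : c ≠ e) (hde : d ≠ e)
    (hta : M t a = 0) (htb : M t b = 0) (hra : M r a ≠ 0) (hsa : M s a ≠ 0) (hrb : M r b ≠ 0)
    (hab : M r a * M s b + M s a * M r b = 0) :
    M r c * (M s d * M t e - M t d * M s e) - M s c * (M r d * M t e - M t d * M r e) +
      M t c * (M r d * M s e - M s d * M r e) = 0 := by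
  have key : ∀ u v : Fin 5, a ≠ u → a ≠ v → b ≠ u → b ≠ v → u ≠ v →
      M s u * M t v + M t u * M s v = 0 ∧ M r u * M t v + M t u * M r v = 0 := by
    intro u v hau hav hbu hbv huv
    have ha := hM r s t hrs hrt hst a u v hau hav huv
    have hb := hM r s t hrs hrt hst b u v hbu hbv huv
    rw [hta] at ha
    rw [htb] at hb
    constructor
    · have : 2 * M r a * M r b * (M s u * M t v + M t u * M s v) = 0 := by
        linear_combination M r b * ha + M r a * hb - (M r u * M t v + M r v * M t u) * hab
      simpa [h2, hra, hrb] using this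
    · have : 2 * M s a * M r b * (M r u * M t v + M t u * M r v) = 0 := by
        linear_combination M r b * ha - M r a * hb + (M r u * M t v + M r v * M t u) * hab
      simpa [h2, hsa, hrb] using this
  obtain ⟨cd1, cd2⟩ := key c d hac had hbc hbd hcd
  obtain ⟨ce1, ce2⟩ := key c e hac hae hbc hbe hce
  obtain ⟨de1, de2⟩ := key d e had hae hbd hbe hde
  by_cases hc : M t c = 0
  · by_cases hd : M t d = 0
    · by_cases he : M t e = 0
      · rw [hc, hd, he]; ring
      · have := det_eq_zero_of_permanents_eq_zero (cr := M r e) (cs := M s e) (dr := M r c)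
          (ds := M s c) (dt := M t c) (er := M r d) (es := M s d) (et := M t d) he
          (by linear_combination ce2) (by linear_combination ce1) (by linear_combination de2)
          (by linear_combination de1)
        linear_combination this
    · have := det_eq_zero_of_permanents_eq_zero (cr := M r d) (cs := M s d) (dr := M r c)
        (ds := M s c) (dt := M t c) (er := M r e) (es := M s e) (et := M t e) hd
        (by linear_combination cd2) (by linear_combination cd1) (by linear_combination de2)
        (by linear_combination de1)
      linear_combination -this
  · exact det_eq_zero_of_permanents_eq_zero hc cd2 cd1 ce2 ce1

lemma twoRowPermanentsVanish_of_zero_entry (hM : SubpermanentsVanish M) (h2 : (2 : K) ≠ 0)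
    (hcol : ∀ j, ∃ i, M i j ≠ 0) {r s t : Fin 3} (hrs : r ≠ s) (hrt : r ≠ t) (hst : s ≠ t)
    {a b c d e : Fin 5}
    (hac : a ≠ c) (had : a ≠ d) (hae : a ≠ e) (hbc : b ≠ c) (hbd : b ≠ d) (hbe : b ≠ e)
    (hcd : c ≠ d) (hce : c ≠ e) (hde : d ≠ e)
    (hdet : M r c * (M s d * M t e - M t d * M s e) - M s c * (M r d * M t e - M t d * M r e) +
      M t c * (M r d * M s e - M s d * M r e) ≠ 0)
    (hrs' : M r a * M s b + M s a * M r b = 0) (hrt' : M r a * M t b + M t a * M r b = 0)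
    (hst' : M s a * M t b + M t a * M s b = 0) (hta : M t a = 0) :
    TwoRowPermanentsVanish M := by
  by_cases hra : M r a = 0
  · refine twoRowPermanentsVanish_of_two_zeros hM hrs hrt hst hra hta fun hsa => ?_
    obtain ⟨i, hi⟩ := hcol a
    rcases eq_or_eq_or_eq_of_distinct hrs hrt hst i with rfl | rfl | rfl <;> contradiction
  by_cases hsa : M s a = 0
  · exact twoRowPermanentsVanish_of_two_zeros hM hrs.symm hst hrt hsa hta hra
  have htb : M t b = 0 := by simpa [hta, hra] using hrt'
  have hrb : M r b ≠ 0 := by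
    intro hrb
    have hsb : M s b = 0 := by simpa [hrb, hra] using hrs'
    obtain ⟨i, hi⟩ := hcol b
    rcases eq_or_eq_or_eq_of_distinct hrs hrt hst i with rfl | rfl | rfl <;> contradiction
  exact absurd (det_eq_zero_of_pair hM h2 hrs hrt hst hac had hae hbc hbd hbe hcd hce hde
    hta htb hra hsa hrb hrs') hdet

lemma twoRowPermanentsVanish_of_det_ne_zero (hM : SubpermanentsVanish M) (h2 : (2 : K) ≠ 0)
    (hcol : ∀ j, ∃ i, M i j ≠ 0) {a b c d e : Fin 5} (hab : a ≠ b)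
    (hac : a ≠ c) (had : a ≠ d) (hae : a ≠ e) (hbc : b ≠ c) (hbd : b ≠ d) (hbe : b ≠ e)
    (hcd : c ≠ d) (hce : c ≠ e) (hde : d ≠ e)
    (hdet : M 0 c * (M 1 d * M 2 e - M 2 d * M 1 e) - M 1 c * (M 0 d * M 2 e - M 2 d * M 0 e) +
      M 2 c * (M 0 d * M 1 e - M 1 d * M 0 e) ≠ 0) :
    TwoRowPermanentsVanish M := by
  have h := hM 0 1 2 (by decide) (by decide) (by decide)
  have hc := h c a b hac.symm hbc.symm hab
  have hd := h d a b had.symm hbd.symm hab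
  have he := h e a b hae.symm hbe.symm hab
  have h12 : M 1 a * M 2 b + M 2 a * M 1 b = 0 := by
    refine (mul_eq_zero.mp ?_).resolve_left hdet
    linear_combination (M 1 d * M 2 e - M 2 d * M 1 e) * hc
      - (M 1 c * M 2 e - M 2 c * M 1 e) * hd + (M 1 c * M 2 d - M 2 c * M 1 d) * he
  have h02 : M 0 a * M 2 b + M 2 a * M 0 b = 0 := by
    refine (mul_eq_zero.mp ?_).resolve_left hdet
    linear_combination -(M 0 d * M 2 e - M 2 d * M 0 e) * hc
      + (M 0 c * M 2 e - M 2 c * M 0 e) * hd - (M 0 c * M 2 d - M 2 c * M 0 d) * he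
  have h01 : M 0 a * M 1 b + M 1 a * M 0 b = 0 := by
    refine (mul_eq_zero.mp ?_).resolve_left hdet
    linear_combination (M 0 d * M 1 e - M 1 d * M 0 e) * hc
      - (M 0 c * M 1 e - M 1 c * M 0 e) * hd + (M 0 c * M 1 d - M 1 c * M 0 d) * he
  by_cases ha2 : M 2 a = 0
  · exact twoRowPermanentsVanish_of_zero_entry (r := 0) (s := 1) (t := 2) hM h2 hcol (by decide)
      (by decide) (by decide) hac had hae hbc hbd hbe hcd hce hde hdet h01 h02 h12 ha2
  by_cases ha1 : M 1 a = 0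
  · exact twoRowPermanentsVanish_of_zero_entry (r := 0) (s := 2) (t := 1) hM h2 hcol (by decide)
      (by decide) (by decide) hac had hae hbc hbd hbe hcd hce hde
      (fun h0 => hdet (by linear_combination -h0)) h02 h01 (by linear_combination h12) ha1
  by_cases ha0 : M 0 a = 0
  · exact twoRowPermanentsVanish_of_zero_entry (r := 1) (s := 2) (t := 0) hM h2 hcol (by decide)
      (by decide) (by decide) hac had hae hbc hbd hbe hcd hce hde
      (fun h0 => hdet (by linear_combination h0)) h12 (by linear_combination h01)
      (by linear_combination h02) ha0
  have hb0 : M 0 b = 0 := by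
    have : 2 * M 1 a * M 2 a * M 0 b = 0 := by
      linear_combination M 2 a * h01 + M 1 a * h02 - M 0 a * h12
    simpa [h2, ha1, ha2] using this
  have hb1 : M 1 b = 0 := by simpa [hb0, ha0] using h01
  have hb2 : M 2 b = 0 := by simpa [hb0, ha0] using h02
  obtain ⟨i, hi⟩ := hcol b
  fin_cases i <;> contradiction

lemma minor_eq_zero_of_row_eq {r s t : Fin 3} (hrs : r ≠ s) (hrt : r ≠ t) (hst : s ≠ t)
    {α β : K} (hlin : ∀ j, M t j = α * M r j + β * M s j) {j j' : Fin 5}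
    (h : M r j * M s j' - M r j' * M s j = 0) (i i' : Fin 3) :
    M i j * M i' j' - M i j' * M i' j = 0 := by
  rcases eq_or_eq_or_eq_of_distinct hrs hrt hst i with rfl | rfl | rfl <;>
    rcases eq_or_eq_or_eq_of_distinct hrs hrt hst i' with rfl | rfl | rfl <;>
    try simp only [hlin]
  · ring
  · exact h
  · linear_combination β * h
  · linear_combination -h
  · ring
  · linear_combination -α * h
  · linear_combination -β * h
  · linear_combination α * h
  · ring

lemma four_columns_of_row_eq (h3 : (3 : K) = 0) (hM : SubpermanentsVanish M)
    (hcol : ∀ j, ∃ i, M i j ≠ 0) {r s t : Fin 3} (hrs : r ≠ s) (hrt : r ≠ t) (hst : s ≠ t)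
    {α β : K} (hlin : ∀ j, M t j = α * M r j + β * M s j) :
    TwoRowPermanentsVanish M ∨ FourColumnMinorsVanish M := by
  by_cases hαβ : α = 0 ∧ β = 0
  · exact .inl (twoRowPermanentsVanish_of_row_eq_zero (t := t) fun j => by
      rw [hlin, hαβ.1, hαβ.2]; ring)
  right
  by_cases hl : ∀ j, α * M r j - β * M s j = 0
  · refine ⟨{0, 1, 2, 3}, by decide, fun i i' j j' _ _ => ?_⟩
    refine minor_eq_zero_of_row_eq hrs hrt hst hlin ?_ i i'
    by_cases hα : α = 0
    · have hβ : β ≠ 0 := fun hβ => hαβ ⟨hα, hβ⟩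
      refine (mul_eq_zero.mp ?_).resolve_left hβ
      linear_combination M r j' * hl j - M r j * hl j'
    · refine (mul_eq_zero.mp ?_).resolve_left hα
      linear_combination M s j' * hl j - M s j * hl j'
  push Not at hl
  obtain ⟨a, ha⟩ := hl
  refine ⟨{a}ᶜ, by simp [Finset.card_compl], fun i i' j j' hj hj' => ?_⟩
  simp only [Finset.mem_compl, Finset.mem_singleton] at hj hj'
  refine minor_eq_zero_of_row_eq hrs hrt hst hlin ?_ i i'
  by_cases hjj' : j = j'
  · subst hjj'; ring
  obtain ⟨b, hb⟩ : ∃ b, b ∉ ({a, j, j'} : Finset (Fin 5)) :=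
    exists_notMem_of_card_le_four (Finset.card_le_three.trans (by norm_num))
  simp only [Finset.mem_insert, Finset.mem_singleton, not_or] at hb
  obtain ⟨hba, hbj, hbj'⟩ := hb
  have e := hM r s t hrs hrt hst a b j (Ne.symm hba) (Ne.symm hj) hbj
  have e' := hM r s t hrs hrt hst a b j' (Ne.symm hba) (Ne.symm hj') hbj'
  simp only [hlin] at e e'
  set P := α * (M r a * M s b + M s a * M r b) + β * (M s a * M s b)
  set Q := α * (M r a * M r b) + β * (M r a * M s b + M s a * M r b)
  have e1 : P * M r j + Q * M s j = 0 := by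
    linear_combination (P * M r j + Q * M s j) * h3 - e
  have e1' : P * M r j' + Q * M s j' = 0 := by
    linear_combination (P * M r j' + Q * M s j') * h3 - e'
  by_contra hne
  have hP0 : P = 0 := by
    refine (mul_eq_zero.mp ?_).resolve_right hne
    linear_combination M s j' * e1 - M s j * e1'
  have hQ0 : Q = 0 := by
    refine (mul_eq_zero.mp ?_).resolve_right hne
    linear_combination M r j * e1' - M r j' * e1
  have hlb : α * M r b - β * M s b = 0 := by
    refine (mul_eq_zero.mp ?_).resolve_left ha
    linear_combination α * hQ0 + β * hP0 - α * β * (M r a * M s b + M s a * M r b) * h3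
  have hrb : M r b = 0 := by
    refine (mul_eq_zero.mp ?_).resolve_left ha
    linear_combination -hQ0 + α * M r a * M r b * h3 - M r a * hlb
  have hsb : M s b = 0 := by
    refine (mul_eq_zero.mp ?_).resolve_left ha
    linear_combination hP0 - β * M s a * M s b * h3 - M s a * hlb
  obtain ⟨i, hi⟩ := hcol b
  rcases eq_or_eq_or_eq_of_distinct hrs hrt hst i with rfl | rfl | rfl
  · exact hi hrb
  · exact hi hsb
  · exact hi (by rw [hlin, hrb, hsb]; ring)

lemma exists_row_relation
    (hdet : ∀ c d e : Fin 5, c ≠ d → c ≠ e → d ≠ e →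
      M 0 c * (M 1 d * M 2 e - M 2 d * M 1 e) - M 1 c * (M 0 d * M 2 e - M 2 d * M 0 e) +
        M 2 c * (M 0 d * M 1 e - M 1 d * M 0 e) = 0) :
    ∃ w : Fin 3 → K, w ≠ 0 ∧ ∀ j, w 0 * M 0 j + w 1 * M 1 j + w 2 * M 2 j = 0 := by
  by_cases hminor : ∀ c d, M 0 c * M 1 d - M 1 c * M 0 d = 0
  · by_cases hrow : ∀ c, M 0 c = 0
    · exact ⟨![1, 0, 0], fun h => by simpa using congrFun h 0, fun j => by simp [hrow]⟩
    push Not at hrow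
    obtain ⟨c, hc⟩ := hrow
    refine ⟨![-M 1 c, M 0 c, 0], fun h => hc (by simpa using congrFun h 1), fun j => ?_⟩
    simp only [Matrix.cons_val]
    linear_combination hminor c j
  push Not at hminor
  obtain ⟨c, d, hcd⟩ := hminor
  refine ⟨![M 1 c * M 2 d - M 2 c * M 1 d, M 2 c * M 0 d - M 0 c * M 2 d,
    M 0 c * M 1 d - M 1 c * M 0 d], fun h => hcd (by simpa using congrFun h 2), fun j => ?_⟩
  simp only [Matrix.cons_val]
  by_cases hcd' : c = d
  · subst hcd'; ring
  by_cases hcj : c = j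
  · subst hcj; ring
  by_cases hdj : d = j
  · subst hdj; ring
  linear_combination hdet c d j hcd' hcj hdj

/-- Over a field of characteristic three, a `3 × 5` matrix without zero columns all of whose
`3 × 3` subpermanents vanish has two rows with vanishing `2 × 2` permanents, or four columns with
vanishing `2 × 2` minors. -/
theorem twoRowPermanentsVanish_or_fourColumnMinorsVanish (h3 : (3 : K) = 0)
    (hM : SubpermanentsVanish M) (hcol : ∀ j, ∃ i, M i j ≠ 0) :
    TwoRowPermanentsVanish M ∨ FourColumnMinorsVanish M := by
  have h2 : (2 : K) ≠ 0 := fun h => one_ne_zero (α := K) (by linear_combination h3 - h)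
  by_cases hdet : ∀ c d e : Fin 5, c ≠ d → c ≠ e → d ≠ e →
      M 0 c * (M 1 d * M 2 e - M 2 d * M 1 e) - M 1 c * (M 0 d * M 2 e - M 2 d * M 0 e) +
        M 2 c * (M 0 d * M 1 e - M 1 d * M 0 e) = 0
  · obtain ⟨w, hw, hrel⟩ := exists_row_relation hdet
    by_cases hw2 : w 2 = 0
    · by_cases hw1 : w 1 = 0
      · have hw0 : w 0 ≠ 0 := fun hw0 => hw (by ext i; fin_cases i <;> simpa)
        refine four_columns_of_row_eq (r := 1) (s := 2) (t := 0) h3 hM hcol (by decide) (by decide)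
          (by decide) (α := -w 1 / w 0) (β := -w 2 / w 0) fun j => ?_
        field_simp
        linear_combination hrel j
      · refine four_columns_of_row_eq (r := 0) (s := 2) (t := 1) h3 hM hcol (by decide) (by decide)
          (by decide) (α := -w 0 / w 1) (β := -w 2 / w 1) fun j => ?_
        field_simp
        linear_combination hrel j
    · refine four_columns_of_row_eq (r := 0) (s := 1) (t := 2) h3 hM hcol (by decide) (by decide)
        (by decide) (α := -w 0 / w 2) (β := -w 1 / w 2) fun j => ?_
      field_simp
      linear_combination hrel j
  · push Not at hdet
    obtain ⟨c, d, e, hcd, hce, hde, hdet⟩ := hdet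
    obtain ⟨a, ha⟩ : ∃ a, a ∉ ({c, d, e} : Finset (Fin 5)) :=
      exists_notMem_of_card_le_four (Finset.card_le_three.trans (by norm_num))
    obtain ⟨b, hb⟩ : ∃ b, b ∉ ({a, c, d, e} : Finset (Fin 5)) :=
      exists_notMem_of_card_le_four Finset.card_le_four
    simp only [Finset.mem_insert, Finset.mem_singleton, not_or] at ha hb
    exact .inl (twoRowPermanentsVanish_of_det_ne_zero hM h2 hcol (Ne.symm hb.1) ha.1 ha.2.1 ha.2.2
      hb.2.1 hb.2.2.1 hb.2.2.2 hcd hce hde hdet)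

end Field

theorem stmt8 (k : Type*) [Field k] (h3 : ringChar k = 3)
    (𝔭 : Ideal (MvPolynomial (Fin 3 × Fin 5) k)) (hprime : 𝔭.IsPrime)
    (hI : permIdeal k 3 3 5 ≤ 𝔭) :
    (∃ j : Fin 5, ∀ i : Fin 3, X (i, j) ∈ 𝔭) ∨
      (∃ r r' : Fin 3, r ≠ r' ∧ ∀ j j' : Fin 5, j < j' →
        X (r, j) * X (r', j') + X (r, j') * X (r', j) ∈ 𝔭) ∨
      (∃ S : Finset (Fin 5), S.card = 4 ∧ ∀ (i i' : Fin 3) (j j' : Fin 5), j ∈ S → j' ∈ S →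
        X (i, j) * X (i', j') - X (i, j') * X (i', j) ∈ 𝔭) := by
  have : (3 : k) = 0 := by
    have := ringChar.Nat.cast_ringChar (R := k)
    rw [h3] at this
    exact_mod_cast this
  let φ := (algebraMap (MvPolynomial (Fin 3 × Fin 5) k ⧸ 𝔭)
    (FractionRing (MvPolynomial (Fin 3 × Fin 5) k ⧸ 𝔭))).comp (Ideal.Quotient.mk 𝔭)
  have hφ : ∀ p, p ∈ 𝔭 ↔ φ p = 0 := fun p => by
    rw [RingHom.comp_apply, FaithfulSMul.algebraMap_eq_zero_iff, Ideal.Quotient.eq_zero_iff_mem]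
  let M : Fin 3 → Fin 5 → FractionRing (MvPolynomial (Fin 3 × Fin 5) k ⧸ 𝔭) :=
    fun i j => φ (X (i, j))
  have hK3 : (3 : FractionRing (MvPolynomial (Fin 3 × Fin 5) k ⧸ 𝔭)) = 0 := by
    have h := congrArg (fun c => φ (C c)) this
    rwa [map_ofNat, map_ofNat, map_zero, map_zero] at h
  have hM : SubpermanentsVanish M := by
    refine subpermanentsVanish_of_lt fun i j l hij hjl => ?_
    have hmem : Matrix.permanent (Matrix.of fun (a b : Fin 3) =>
        (X (a, ![i, j, l] b) : MvPolynomial (Fin 3 × Fin 5) k)) ∈ 𝔭 := by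
      refine hI (Ideal.subset_span ⟨id, ![i, j, l], strictMono_id, ?_, rfl⟩)
      rw [Fin.strictMono_iff_lt_succ]
      intro a
      fin_cases a <;> simpa
    rw [hφ, permanent_fin_three] at hmem
    simp only [Matrix.of_apply, Matrix.cons_val, map_add, map_mul] at hmem
    exact hmem
  by_cases hcol : ∀ j, ∃ i, M i j ≠ 0
  · right
    rcases twoRowPermanentsVanish_or_fourColumnMinorsVanish hK3 hM hcol with
      ⟨r, r', hrr', h⟩ | ⟨S, hS, h⟩
    · refine .inl ⟨r, r', hrr', fun j j' hjj' => ?_⟩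
      rw [hφ]
      simpa using h j j' hjj'
    · refine .inr ⟨S, hS, fun i i' j j' hj hj' => ?_⟩
      rw [hφ]
      simpa using h i i' j j' hj hj'
  · push Not at hcol
    obtain ⟨j, hj⟩ := hcol
    exact .inl ⟨j, fun i => (hφ _).mpr (hj i)⟩
end

section
/- Let k be a field, let M = (x_{i,j}) be the generic d×(d+1) matrix over k, and define f_1, …, f_{d+1} and g_1, …, g_d as follows: P_q is the permanent of M with column q deleted, B_{r,p,q} = ∂P_q/∂x_{r,p}, f_p is the determinant of the d×d matrix (B_{r,s,p}) with r ∈ {1,…,d} and s ∈ {1,…,d+1} \ {p}, and g_r is the determinant of the (d+1)×(d+1) matrix (B_{r,p,q})_{p,q}. Let J_d = I_d(d,d+1) + ⟨f_1, …, f_{d+1}, g_1, …, g_d⟩. Then every minimal prime ideal Q over I_d(d,d+1) either contains all entries of some row of M, or contains all entries of some column of M, or contains J_d. -/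
open MvPolynomial

/-- `P_q`: the permanent of the `d × d` matrix obtained from the generic `d × (d+1)`
matrix by deleting column `q`. -/
noncomputable def Pq (k : Type*) [Field k] (d : ℕ) (q : Fin (d + 1)) :
    MvPolynomial (Fin d × Fin (d + 1)) k :=
  Matrix.permanent (Matrix.of fun (i j : Fin d) => X (i, q.succAbove j))

/-- `B_{r,p,q} = ∂P_q/∂x_{r,p}`. -/
noncomputable def Bpd (k : Type*) [Field k] (d : ℕ) (r : Fin d) (p q : Fin (d + 1)) :
    MvPolynomial (Fin d × Fin (d + 1)) k :=
  MvPolynomial.pderiv (r, p) (Pq k d q)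

/-- `f_p`: the determinant of the `d × d` matrix `(B_{r,s,p})` with `s` ranging over
the columns different from `p`. -/
noncomputable def fp (k : Type*) [Field k] (d : ℕ) (p : Fin (d + 1)) :
    MvPolynomial (Fin d × Fin (d + 1)) k :=
  Matrix.det (Matrix.of fun (r s : Fin d) => Bpd k d r (p.succAbove s) p)

/-- `g_r`: the determinant of the `(d+1) × (d+1)` matrix `(B_{r,p,q})_{p,q}`. -/
noncomputable def gr (k : Type*) [Field k] (d : ℕ) (r : Fin d) :
    MvPolynomial (Fin d × Fin (d + 1)) k :=
  Matrix.det (Matrix.of fun (p q : Fin (d + 1)) => Bpd k d r p q)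

/-- `J_d = I_d(d,d+1) + ⟨f_p, g_r⟩`. -/
noncomputable def Jd (k : Type*) [Field k] (d : ℕ) :
    Ideal (MvPolynomial (Fin d × Fin (d + 1)) k) :=
  permIdeal k d d (d + 1) ⊔
    Ideal.span ({p | ∃ q : Fin (d + 1), p = fp k d q} ∪ {p | ∃ r : Fin d, p = gr k d r})

/-- A prime containing all entries of `v ᵥ* A` but not all of `v` contains `det A`. -/
theorem Ideal.IsPrime.det_mem_of_vecMul_mem {R n : Type*} [CommRing R] [Fintype n]
    [DecidableEq n] {Q : Ideal R} (hQ : Q.IsPrime) (A : Matrix n n R) (v : n → R)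
    (hA : ∀ j, Matrix.vecMul v A j ∈ Q) {i : n} (hi : v i ∉ Q) : A.det ∈ Q := by
  have h : Matrix.vecMul (Matrix.vecMul v A) A.adjugate i = A.det * v i := by
    rw [Matrix.vecMul_vecMul, Matrix.mul_adjugate, Matrix.vecMul_smul, Matrix.vecMul_one]
    rfl
  have hmem : A.det * v i ∈ Q := by
    rw [← h]
    exact Q.sum_mem fun j _ => Q.mul_mem_right _ (hA j)
  exact (hQ.mem_or_mem hmem).resolve_right hi

theorem Pq_mem_permIdeal (k : Type*) [Field k] (d : ℕ) (q : Fin (d + 1)) :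
    Pq k d q ∈ permIdeal k d d (d + 1) :=
  Ideal.subset_span ⟨id, q.succAbove, strictMono_id, q.strictMono_succAbove, rfl⟩

/-- A derivation applied to a finite product that moves only the factor at `a`. -/
theorem Derivation.prod_eq_update {R A ι : Type*} [CommSemiring R] [CommSemiring A]
    [Algebra R A] [Fintype ι] [DecidableEq ι] (D : Derivation R A A) (f : ι → A) (a : ι)
    (hD : ∀ i, i ≠ a → D (f i) = 0) :
    D (∏ i, f i) = ∏ i, Function.update f a (D (f a)) i := by
  have h0 (t : Finset ι) (ht : a ∉ t) : D (∏ i ∈ t, f i) = 0 := by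
    induction t using Finset.induction_on with
    | empty => simp
    | insert b t hb ih =>
      rw [Finset.mem_insert, not_or] at ht
      rw [Finset.prod_insert hb, D.leibniz, ih ht.2, hD b (Ne.symm ht.1)]
      simp
  rw [Finset.prod_update_of_mem (Finset.mem_univ a), Finset.sdiff_singleton_eq_erase,
    ← Finset.mul_prod_erase _ f (Finset.mem_univ a), D.leibniz,
    h0 _ (Finset.notMem_erase a _), smul_zero, zero_add, smul_eq_mul, mul_comm]

/-- Finite sums of derivations are evaluated pointwise. -/
theorem Derivation.finsetSum_apply {R A M ι : Type*} [CommSemiring R] [CommSemiring A]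
    [AddCommMonoid M] [Algebra R A] [Module A M] [Module R M] (t : Finset ι)
    (D : ι → Derivation R A M) (x : A) : (∑ i ∈ t, D i) x = ∑ i ∈ t, D i x := by
  rw [← Derivation.coeFnAddMonoidHom_apply, map_sum, Finset.sum_apply]
  rfl

/-- Laplace expansion of `P_q` along row `r`. -/
theorem sum_X_row_mul_Bpd (k : Type*) [Field k] (d : ℕ) (r : Fin d) (q : Fin (d + 1)) :
    ∑ p, X (r, p) * Bpd k d r p q = Pq k d q := by
  let D : Derivation k (MvPolynomial (Fin d × Fin (d + 1)) k) _ :=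
    ∑ p : Fin (d + 1), (X (r, p) : MvPolynomial (Fin d × Fin (d + 1)) k) • pderiv (r, p)
  have hsum (f) : D f = ∑ p, X (r, p) * pderiv (r, p) f := by
    simp [D, Derivation.finsetSum_apply]
  have hX (i j) : D (X (i, j)) = if i = r then X (i, j) else 0 := by
    rw [hsum]
    simp only [pderiv_X, Pi.single_apply, Prod.mk.injEq]
    split_ifs with h <;> simp [h]
  simp only [Bpd]
  rw [← hsum, Pq, Matrix.permanent, map_sum]
  refine Finset.sum_congr rfl fun σ _ => ?_
  simp only [Matrix.of_apply]
  rw [D.prod_eq_update _ (σ.symm r)]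
  · refine Finset.prod_congr rfl fun i _ => ?_
    rcases eq_or_ne i (σ.symm r) with rfl | h
    · simp [hX]
    · simp [h]
  · intro i hi
    rw [hX, if_neg]
    rintro rfl
    simp at hi

/-- Laplace expansion of `P_s` along column `p`, where `s ≠ p`. -/
theorem sum_X_col_mul_Bpd (k : Type*) [Field k] (d : ℕ) (p : Fin (d + 1)) (s : Fin d) :
    ∑ r, X (r, p) * Bpd k d r (p.succAbove s) p = Pq k d (p.succAbove s) := by
  let D : Derivation k (MvPolynomial (Fin d × Fin (d + 1)) k) _ :=
    ∑ r : Fin d, (X (r, p) : MvPolynomial (Fin d × Fin (d + 1)) k) • pderiv (r, p.succAbove s)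
  have hsum (f) : D f = ∑ r, X (r, p) * pderiv (r, p.succAbove s) f := by
    simp [D, Derivation.finsetSum_apply]
  have hX (i j) : D (X (i, j)) = if j = p.succAbove s then X (i, p) else 0 := by
    rw [hsum]
    simp only [pderiv_X, Pi.single_apply, Prod.mk.injEq]
    split_ifs with h <;> simp [h]
  have hc (j : Fin d) : ∃ t, (p.succAbove s).succAbove t =
      Function.update p.succAbove s p j := by
    refine Fin.exists_succAbove_eq ?_
    rcases eq_or_ne j s with rfl | h
    · simp
    · simp [h]
  choose τ hτ using hc
  have hinj : Function.Injective τ := by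
    intro i j hij
    have h := congrArg (p.succAbove s).succAbove hij
    rw [hτ, hτ] at h
    simp only [Function.update_apply] at h
    split_ifs at h with h1 h2 h2
    · exact h1.trans h2.symm
    · exact absurd h.symm (p.succAbove_ne j)
    · exact absurd h (p.succAbove_ne i)
    · exact p.succAbove_right_injective h
  let e : Equiv.Perm (Fin d) := Equiv.ofBijective τ (Finite.injective_iff_bijective.mp hinj)
  simp only [Bpd]
  rw [← hsum]
  conv_rhs => rw [Pq, ← Matrix.permanent_permute_rows e]
  rw [Pq, Matrix.permanent, Matrix.permanent, map_sum]
  refine Finset.sum_congr rfl fun σ _ => ?_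
  simp only [Matrix.of_apply]
  rw [D.prod_eq_update _ s]
  · refine Finset.prod_congr rfl fun i _ => ?_
    change _ = X (σ i, (p.succAbove s).succAbove (τ i))
    rw [hτ]
    rcases eq_or_ne i s with rfl | h
    · simp [hX]
    · simp [h]
  · intro i hi
    rw [hX, if_neg]
    simpa using hi

theorem stmt10 (k : Type*) [Field k] (d : ℕ)
    (Q : Ideal (MvPolynomial (Fin d × Fin (d + 1)) k))
    (hQ : Q ∈ (permIdeal k d d (d + 1)).minimalPrimes) :
    (∃ i : Fin d, ∀ j : Fin (d + 1), X (i, j) ∈ Q) ∨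
      (∃ j : Fin (d + 1), ∀ i : Fin d, X (i, j) ∈ Q) ∨
      Jd k d ≤ Q := by
  have hprime : Q.IsPrime := hQ.1.1
  have hle : permIdeal k d d (d + 1) ≤ Q := hQ.1.2
  by_contra! h
  obtain ⟨hrow, hcol, hJ⟩ := h
  refine hJ (sup_le hle (Ideal.span_le.mpr ?_))
  rintro _ (⟨p, rfl⟩ | ⟨r, rfl⟩)
  · obtain ⟨i, hi⟩ := hcol p
    refine hprime.det_mem_of_vecMul_mem _ (fun r => X (r, p)) (fun s => ?_) hi
    exact hle ((congrArg (· ∈ _) (sum_X_col_mul_Bpd k d p s)).mpr (Pq_mem_permIdeal k d _))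
  · obtain ⟨j, hj⟩ := hrow r
    refine hprime.det_mem_of_vecMul_mem _ (fun p => X (r, p)) (fun q => ?_) hj
    exact hle ((congrArg (· ∈ _) (sum_X_row_mul_Bpd k d r q)).mpr (Pq_mem_permIdeal k d _))
end
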